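/- (Main theorem) Let λ > -1/2 and μ > 0. Let C̃_n^{(λ,μ)} denote the orthonormal generalized Gegenbauer polynomials, given by C̃_{2n}^{(λ,μ)}(t) = ã_{2n}^{(λ,μ)} P_n^{(λ-1/2,μ-1/2)}(2t²-1) and C̃_{2n+1}^{(λ,μ)}(t) = ã_{2n+1}^{(λ,μ)} t P_n^{(λ-1/2,μ+1/2)}(2t²-1), with ã_{2n}^{(λ,μ)} = ((2n+λ+μ)Γ(n+1)Γ(n+λ+μ)/(Γ(n+λ+1/2)Γ(n+μ+1/2)))^{1/2} and ã_{2n+1}^{(λ,μ)} = ((2n+λ+μ+1)Γ(n+1)Γ(n+λ+μ+1)/(Γ(n+λ+1/2)Γ(n+μ+3/2)))^{1/2}. Then max_{t ∈ [-1,1]} |C̃_n^{(λ,μ)}(t)| ≍ n^{max(λ,μ)} as n → ∞. -/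

import Mathlib

open Real Set

/-- Jacobi polynomial `P_n^{(a,b)}` in the standard normalization. -/
noncomputable def jacobiP (a b : ℝ) (n : ℕ) (x : ℝ) : ℝ :=
  (Nat.factorial n : ℝ)⁻¹ *
    ∑ k ∈ Finset.range (n + 1),
      (Nat.choose n k : ℝ) * (ascPochhammer ℝ k).eval ((n : ℝ) + a + b + 1) *
        (ascPochhammer ℝ (n - k)).eval (a + (k : ℝ) + 1) * ((x - 1) / 2) ^ k

/-- Pochhammer symbol `(q)_n` for real `q`. -/
noncomputable def poch (q : ℝ) (n : ℕ) : ℝ := (ascPochhammer ℝ n).eval q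

/-- Normalization constant for even orthonormal generalized Gegenbauer polynomials. -/
noncomputable def atilde2n (l m : ℝ) (n : ℕ) : ℝ :=
  (((2 * n + l + m) * Real.Gamma (n + 1) * Real.Gamma (n + l + m)) /
    (Real.Gamma (n + l + 1 / 2) * Real.Gamma (n + m + 1 / 2))) ^ ((1 : ℝ) / 2)

/-- Normalization constant for odd orthonormal generalized Gegenbauer polynomials. -/
noncomputable def atilde2n1 (l m : ℝ) (n : ℕ) : ℝ :=
  (((2 * n + l + m + 1) * Real.Gamma (n + 1) * Real.Gamma (n + l + m + 1)) /
    (Real.Gamma (n + l + 1 / 2) * Real.Gamma (n + m + 3 / 2))) ^ ((1 : ℝ) / 2)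

/-- Orthonormal generalized Gegenbauer polynomial `C̃_n^{(l,m)}`. -/
noncomputable def orthoGenGegenbauer (l m : ℝ) (n : ℕ) (t : ℝ) : ℝ :=
  if Even n then atilde2n l m (n / 2) * jacobiP (l - 1 / 2) (m - 1 / 2) (n / 2) (2 * t ^ 2 - 1)
  else atilde2n1 l m (n / 2) * t * jacobiP (l - 1 / 2) (m + 1 / 2) (n / 2) (2 * t ^ 2 - 1)

open Polynomial in
theorem descPochhammer_int_smeval_eq_eval (k : ℕ) (r : ℝ) :
    (descPochhammer ℤ k).smeval r = (descPochhammer ℝ k).eval r := by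
  induction k with
  | zero => simp
  | succ k ih =>
    rw [descPochhammer_succ_right, descPochhammer_succ_right, smeval_mul, ih, eval_mul]
    simp [smeval_sub, smeval_X, smeval_natCast]

/-- Chu–Vandermonde identity for rising factorials, in alternating form. -/
theorem sum_choose_mul_ascPochhammer_mul (n : ℕ) (a b : ℝ) :
    ∑ k ∈ Finset.range (n + 1),
      (Nat.choose n k : ℝ) * (ascPochhammer ℝ k).eval ((n : ℝ) + a + b + 1) *
        (ascPochhammer ℝ (n - k)).eval (a + (k : ℝ) + 1) * (-1) ^ k =
      (-1) ^ n * (ascPochhammer ℝ n).eval (b + 1) := by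
  have h := Ring.descPochhammer_smeval_add n (Commute.all (-((n : ℝ) + a + b + 1)) (a + n))
  rw [Finset.Nat.sum_antidiagonal_eq_sum_range_succ_mk] at h
  simp only [descPochhammer_int_smeval_eq_eval] at h
  rw [← neg_neg (b + 1), ascPochhammer_eval_neg_eq_descPochhammer, ← mul_assoc, ← mul_pow,
    show -(b + 1) = -((n : ℝ) + a + b + 1) + (a + n) by ring, h]
  simp only [neg_mul, one_mul, neg_neg, one_pow]
  refine Finset.sum_congr rfl fun k hk => ?_
  have hk' : k ≤ n := Nat.lt_succ_iff.mp (Finset.mem_range.mp hk)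
  rw [← neg_neg ((n : ℝ) + a + b + 1), ascPochhammer_eval_neg_eq_descPochhammer, neg_neg,
    descPochhammer_eval_eq_ascPochhammer (R := ℝ) (a + n), Nat.cast_sub hk',
    show a + (n : ℝ) - (n - k) + 1 = a + k + 1 by ring]
  have : ((-1 : ℝ) ^ k) * (-1) ^ k = 1 := by rw [← mul_pow]; simp
  linear_combination ((Nat.choose n k : ℝ) *
    (descPochhammer ℝ k).eval (-((n : ℝ) + a + b + 1)) *
    (ascPochhammer ℝ (n - k)).eval (a + (k : ℝ) + 1)) * this

/-- Taylor coefficients at `x = 1` (in the variable `(x - 1) / 2`) of `n!` times the Jacobi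
polynomial. -/
noncomputable def jacobiCoeff (a b : ℝ) (n k : ℕ) : ℝ :=
  (Nat.choose n k : ℝ) * (ascPochhammer ℝ k).eval ((n : ℝ) + a + b + 1) *
    (ascPochhammer ℝ (n - k)).eval (a + (k : ℝ) + 1)

theorem ascPochhammer_succ_eval_left (n : ℕ) (x : ℝ) :
    (ascPochhammer ℝ (n + 1)).eval x = x * (ascPochhammer ℝ n).eval (x + 1) := by
  simp [ascPochhammer_succ_left, Polynomial.eval_comp]

theorem jacobiCoeff_succ (a b : ℝ) (n k : ℕ) :
    ((k : ℝ) + 1) * (k + 1 + a) * jacobiCoeff a b n (k + 1) =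
      ((n : ℝ) - k) * (n + k + a + b + 1) * jacobiCoeff a b n k := by
  unfold jacobiCoeff
  rcases lt_or_ge k n with h | h
  · obtain ⟨d, rfl⟩ : ∃ d, n = k + d + 1 := ⟨n - k - 1, by omega⟩
    rw [show k + d + 1 - (k + 1) = d by omega, show k + d + 1 - k = d + 1 by omega,
      ascPochhammer_succ_eval_left d, ascPochhammer_succ_eval]
    have hc := Nat.choose_succ_right_eq (k + d + 1) k
    rw [show k + d + 1 - k = d + 1 by omega] at hc
    have hc' : ((k + d + 1).choose (k + 1) : ℝ) * (k + 1) = ((k + d + 1).choose k : ℝ) * (d + 1) := by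
      exact_mod_cast hc
    push_cast
    rw [show a + ((k : ℝ) + 1) + 1 = a + k + 1 + 1 by ring]
    linear_combination ((k : ℝ) + 1 + a) *
      (Polynomial.eval ((k : ℝ) + d + 1 + a + b + 1) (ascPochhammer ℝ k) *
        ((k : ℝ) + d + 1 + a + b + 1 + k)) *
        Polynomial.eval (a + k + 1 + 1) (ascPochhammer ℝ d) * hc'
  · rw [Nat.choose_eq_zero_of_lt (by omega : n < k + 1)]
    rcases h.eq_or_lt with rfl | h
    · simp
    · simp [Nat.choose_eq_zero_of_lt h]

open Polynomial in
/-- The Jacobi polynomial `P_n^{(a,b)}(2 s - 1)` as a polynomial in `s`. -/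
noncomputable def shiftedJacobi (a b : ℝ) (n : ℕ) : ℝ[X] :=
  (C ((Nat.factorial n : ℝ)⁻¹) *
    ∑ k ∈ Finset.range (n + 1), C (jacobiCoeff a b n k) * X ^ k).comp (X - 1)

theorem shiftedJacobi_eval (a b : ℝ) (n : ℕ) (s : ℝ) :
    (shiftedJacobi a b n).eval s = jacobiP a b n (2 * s - 1) := by
  unfold shiftedJacobi jacobiP jacobiCoeff
  simp [Polynomial.eval_finsetSum,
    show (2 * s - 1 - 1) / 2 = s - 1 by ring]

theorem shiftedJacobi_eval_zero (a b : ℝ) (n : ℕ) :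
    (shiftedJacobi a b n).eval 0 =
      (-1) ^ n * ((ascPochhammer ℝ n).eval (b + 1) / (Nat.factorial n : ℝ)) := by
  rw [shiftedJacobi_eval, jacobiP]
  norm_num
  rw [sum_choose_mul_ascPochhammer_mul]
  ring

theorem shiftedJacobi_eval_one (a b : ℝ) (n : ℕ) :
    (shiftedJacobi a b n).eval 1 = (ascPochhammer ℝ n).eval (a + 1) / (Nat.factorial n : ℝ) := by
  rw [shiftedJacobi_eval, jacobiP, Finset.sum_eq_single 0]
  · simp; ring
  · intro k _ hk
    norm_num [hk]
  · simp

open Polynomial in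
/-- The hypergeometric differential equation satisfied by `P_n^{(a,b)}(2 s - 1)`. -/
theorem shiftedJacobi_ode (a b : ℝ) (n : ℕ) (s : ℝ) :
    s * (1 - s) * (derivative (derivative (shiftedJacobi a b n))).eval s +
      (b + 1 - (a + b + 2) * s) * (derivative (shiftedJacobi a b n)).eval s +
      n * (n + a + b + 1) * (shiftedJacobi a b n).eval s = 0 := by
  set p : ℝ[X] := C ((Nat.factorial n : ℝ)⁻¹) *
    ∑ k ∈ Finset.range (n + 1), C (jacobiCoeff a b n k) * X ^ k with hp
  have hcoeff (k : ℕ) : p.coeff k = (Nat.factorial n : ℝ)⁻¹ * jacobiCoeff a b n k := by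
    rw [hp, coeff_C_mul, finsetSum_coeff]
    simp only [coeff_C_mul_X_pow]
    rw [Finset.sum_ite_eq]
    split_ifs with h
    · rfl
    · rw [jacobiCoeff, Nat.choose_eq_zero_of_lt (by simpa [Nat.lt_succ_iff] using h)]
      simp
  have hode : X * derivative (derivative p) + X * (X * derivative (derivative p)) +
      C (a + 1) * derivative p + C (a + b + 2) * (X * derivative p) =
      C ((n : ℝ) * (n + a + b + 1)) * p := by
    ext k
    have hr := jacobiCoeff_succ a b n k
    rcases k with _ | _ | k
    all_goals
      simp only [coeff_add, coeff_C_mul, coeff_X_mul, coeff_X_mul_zero, coeff_derivative, hcoeff]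
      push_cast at hr ⊢
      linear_combination ((Nat.factorial n : ℝ)⁻¹) * hr
  have h := congrArg (eval (s - 1)) hode
  have hs : shiftedJacobi a b n = p.comp (X - 1) := rfl
  simp [hs, derivative_comp, eval_comp] at h ⊢
  linear_combination -h

/-- A differential inequality of Sonin type: if `G' ≤ K G` where the affine function `q s - p` is
nonpositive and `G' ≥ -K G` where it is nonnegative, then `G` on `[0, 1]` is controlled by its
endpoint values. -/
theorem le_exp_mul_max_of_deriv_bounds {G G' : ℝ → ℝ} {K p q : ℝ} (hK : 0 ≤ K) (hp : 0 < p)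
    (hG : ∀ s, HasDerivAt G (G' s) s) (h0 : 0 ≤ G 0)
    (hle : ∀ s ∈ Icc (0 : ℝ) 1, q * s - p ≤ 0 → G' s ≤ K * G s)
    (hge : ∀ s ∈ Icc (0 : ℝ) 1, 0 ≤ q * s - p → -(K * G s) ≤ G' s)
    {s : ℝ} (hs : s ∈ Icc (0 : ℝ) 1) :
    G s ≤ exp K * max (G 0) (G 1) := by
  have hd (c x : ℝ) : HasDerivAt (fun x => exp (c * x) * G x)
      (exp (c * x) * (c * G x + G' x)) x := by
    have h1 : HasDerivAt (fun x => exp (c * x)) (exp (c * x) * (c * 1)) x :=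
      ((hasDerivAt_id x).const_mul c).exp
    exact (h1.mul (hG x)).congr_deriv (by ring)
  have hM : 0 ≤ max (G 0) (G 1) := le_max_of_le_left h0
  rcases le_total (q * s - p) 0 with h | h
  · have hanti : AntitoneOn (fun x => exp (-K * x) * G x) (Icc 0 s) := by
      refine antitoneOn_of_deriv_nonpos (convex_Icc 0 s)
        (fun x _ => (hd (-K) x).continuousAt.continuousWithinAt)
        (fun x _ => (hd (-K) x).differentiableAt.differentiableWithinAt) fun x hx => ?_
      rw [interior_Icc] at hx
      rw [(hd (-K) x).deriv]
      have hx' : q * x - p ≤ 0 := by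
        rcases le_total q 0 with hq | hq
        · nlinarith [hx.1]
        · nlinarith [hx.2]
      have := hle x ⟨hx.1.le, hx.2.le.trans hs.2⟩ hx'
      exact mul_nonpos_of_nonneg_of_nonpos (exp_pos _).le (by linarith)
    have h1 := hanti ⟨le_rfl, hs.1⟩ ⟨hs.1, le_rfl⟩ hs.1
    simp only [mul_zero, exp_zero, one_mul] at h1
    calc G s = exp (K * s) * (exp (-K * s) * G s) := by
          rw [← mul_assoc, ← exp_add]; simp
      _ ≤ exp (K * s) * max (G 0) (G 1) := by gcongr; exact h1.trans (le_max_left _ _)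
      _ ≤ exp K * max (G 0) (G 1) := by
          gcongr
          nlinarith [hs.2]
  · have hq : 0 ≤ q := by
      by_contra! hq
      nlinarith [hs.1]
    have hmono : MonotoneOn (fun x => exp (K * x) * G x) (Icc s 1) := by
      refine monotoneOn_of_deriv_nonneg (convex_Icc s 1)
        (fun x _ => (hd K x).continuousAt.continuousWithinAt)
        (fun x _ => (hd K x).differentiableAt.differentiableWithinAt) fun x hx => ?_
      rw [interior_Icc] at hx
      rw [(hd K x).deriv]
      have := hge x ⟨hs.1.trans hx.1.le, hx.2.le⟩ (by nlinarith [hx.1])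
      exact mul_nonneg (exp_pos _).le (by linarith)
    have h1 := hmono ⟨le_rfl, hs.2⟩ ⟨hs.2, le_rfl⟩ hs.2
    simp only [mul_one] at h1
    calc G s = exp (-(K * s)) * (exp (K * s) * G s) := by
          rw [← mul_assoc, ← exp_add]; simp
      _ ≤ exp (-(K * s)) * (exp K * max (G 0) (G 1)) := by
          refine mul_le_mul_of_nonneg_left (h1.trans ?_) (exp_pos _).le
          gcongr
          exact le_max_right _ _
      _ ≤ 1 * (exp K * max (G 0) (G 1)) := by
          gcongr
          rw [exp_le_one_iff]
          nlinarith [hs.1]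
      _ = exp K * max (G 0) (G 1) := one_mul _

open Polynomial in
/-- Sonin's function for the hypergeometric equation and its derivative. -/
theorem hasDerivAt_sonin (y : ℝ[X]) (a b N : ℝ)
    (hode : ∀ s : ℝ, s * (1 - s) * (derivative (derivative y)).eval s +
      (b + 1 - (a + b + 2) * s) * (derivative y).eval s + N * y.eval s = 0) (s : ℝ) :
    HasDerivAt (fun s => N * y.eval s ^ 2 + s * (1 - s) * (derivative y).eval s ^ 2)
      ((2 * (a + b + 1) * s - (2 * b + 1)) * (derivative y).eval s ^ 2) s := by
  have h1 := ((y.hasDerivAt s).pow 2).const_mul N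
  have h2 := ((hasDerivAt_id s).mul ((hasDerivAt_id s).const_sub 1)).mul
    (((derivative y).hasDerivAt s).pow 2)
  refine (h1.add h2).congr_deriv ?_
  simp
  linear_combination 2 * (derivative y).eval s * hode s

open Polynomial in
/-- The maximum of a solution of the hypergeometric equation is attained at an endpoint. -/
theorem sq_eval_le_max_of_ode (y : ℝ[X]) {a b N : ℝ} (hN : 0 < N) (hb : 0 < 2 * b + 1)
    (hode : ∀ s : ℝ, s * (1 - s) * (derivative (derivative y)).eval s +
      (b + 1 - (a + b + 2) * s) * (derivative y).eval s + N * y.eval s = 0)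
    {s : ℝ} (hs : s ∈ Icc (0 : ℝ) 1) :
    y.eval s ^ 2 ≤ max (y.eval 0 ^ 2) (y.eval 1 ^ 2) := by
  have h := le_exp_mul_max_of_deriv_bounds (K := 0) le_rfl hb
    (hasDerivAt_sonin y a b N hode) (by simpa using by positivity)
    (fun s _ h => by simpa using mul_nonpos_of_nonpos_of_nonneg h (sq_nonneg _))
    (fun s _ h => by simpa using mul_nonneg h (sq_nonneg _)) hs
  simp only [exp_zero, one_mul, zero_mul, add_zero, sub_self, mul_zero] at h
  rw [← mul_max_of_nonneg _ _ hN.le] at h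
  have : 0 ≤ s * (1 - s) * (derivative y).eval s ^ 2 :=
    mul_nonneg (mul_nonneg hs.1 (by linarith [hs.2])) (sq_nonneg _)
  exact le_of_mul_le_mul_left (by linarith) hN

open Polynomial in
/-- Weighted endpoint bound for `√s y(s)`, where `y` solves the hypergeometric equation with
parameters `a = l - 1/2` and `b = m + 1/2`. -/
theorem mul_sq_eval_le_max_of_ode (y : ℝ[X]) {l m N : ℝ} (hm : 0 < m)
    (hN : 0 ≤ N + 1 / 4 - (l + m) / 2)
    (hode : ∀ s : ℝ, s * (1 - s) * (derivative (derivative y)).eval s +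
      (m + 1 / 2 + 1 - (l - 1 / 2 + (m + 1 / 2) + 2) * s) * (derivative y).eval s +
      N * y.eval s = 0)
    {s : ℝ} (hs : s ∈ Icc (0 : ℝ) 1) :
    (N + 1 / 4 - (l + m) / 2) * (s * y.eval s ^ 2) ≤ exp (|l + m| / m) *
      max ((m / 2 + 1 / 4) * y.eval 0 ^ 2)
        ((N + 1 / 4 - (l + m) / 2 + m / 2) * y.eval 1 ^ 2) := by
  set D := N + 1 / 4 - (l + m) / 2 with hD
  set G : ℝ → ℝ := fun s => D * (s * y.eval s ^ 2) + m / 2 * y.eval s ^ 2 +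
    (1 - s) * (s * (derivative y).eval s + y.eval s / 2) ^ 2 with hG
  have hlow (s : ℝ) (hs : s ∈ Icc (0 : ℝ) 1) :
      D * (s * y.eval s ^ 2) + m / 2 * y.eval s ^ 2 ≤ G s := by
    have : 0 ≤ (1 - s) * (s * (derivative y).eval s + y.eval s / 2) ^ 2 :=
      mul_nonneg (by linarith [hs.2]) (sq_nonneg _)
    simp only [hG]
    linarith
  have hDs (s : ℝ) (hs : s ∈ Icc (0 : ℝ) 1) : 0 ≤ D * (s * y.eval s ^ 2) :=
    mul_nonneg hN (mul_nonneg hs.1 (sq_nonneg _))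
  have hder (s : ℝ) : HasDerivAt G (s * (derivative y).eval s ^ 2 * (2 * (l + m) * s - 2 * m) -
      (l + m) / 2 * y.eval s ^ 2) s := by
    have hy := y.hasDerivAt s
    have hy' := (derivative y).hasDerivAt s
    have hid := hasDerivAt_id s
    refine ((((hid.mul (hy.pow 2)).const_mul D).add ((hy.pow 2).const_mul (m / 2))).add
      ((hid.const_sub 1).mul (((hid.mul hy').add (hy.div_const 2)).pow 2))).congr_deriv ?_
    simp [hD]
    linear_combination (2 * (s * (derivative y).eval s + y.eval s / 2)) * hode s
  have hK (s : ℝ) (hs : s ∈ Icc (0 : ℝ) 1) :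
      |(l + m) / 2 * y.eval s ^ 2| ≤ |l + m| / m * G s := by
    calc |(l + m) / 2 * y.eval s ^ 2| = |l + m| / m * (m / 2 * y.eval s ^ 2) := by
          rw [abs_mul, abs_div, abs_two, abs_of_nonneg (sq_nonneg (y.eval s))]
          field_simp
      _ ≤ |l + m| / m * G s := by
          gcongr
          linarith [hlow s hs, hDs s hs]
  have hmain := le_exp_mul_max_of_deriv_bounds (K := |l + m| / m) (p := 2 * m) (q := 2 * (l + m))
    (by positivity) (by positivity) hder (by simp only [hG]; norm_num; positivity)
    (fun s hs h => by
      have h1 := (abs_le.mp (hK s hs)).1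
      have h2 : s * (derivative y).eval s ^ 2 * (2 * (l + m) * s - 2 * m) ≤ 0 :=
        mul_nonpos_of_nonneg_of_nonpos (mul_nonneg hs.1 (sq_nonneg _)) h
      linarith)
    (fun s hs h => by
      have h1 := (abs_le.mp (hK s hs)).2
      have h2 : 0 ≤ s * (derivative y).eval s ^ 2 * (2 * (l + m) * s - 2 * m) :=
        mul_nonneg (mul_nonneg hs.1 (sq_nonneg _)) h
      linarith) hs
  have e0 : G 0 = (m / 2 + 1 / 4) * y.eval 0 ^ 2 := by simp only [hG]; ring
  have e1 : G 1 = (D + m / 2) * y.eval 1 ^ 2 := by simp only [hG]; ring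
  rw [e0, e1] at hmain
  have : 0 ≤ m / 2 * y.eval s ^ 2 := by positivity
  linarith [hlow s hs]

open Polynomial in
/-- A solution of the hypergeometric equation stays comparable to its value at `0` at distance
`c² / n²` from `0`. -/
theorem half_abs_eval_zero_le_of_ode (y : ℝ[X]) {a b N T : ℝ} (hN : 0 ≤ N) (hT : 0 ≤ T)
    (hT2 : T ^ 2 ≤ 1 / 2) (hTb : 2 * (a + b + 1) * T ^ 2 ≤ 2 * b + 1) (hab : 0 ≤ a + b + 1)
    (hTN : 32 * N * T ^ 2 ≤ 1)
    (hode : ∀ s : ℝ, s * (1 - s) * (derivative (derivative y)).eval s +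
      (b + 1 - (a + b + 2) * s) * (derivative y).eval s + N * y.eval s = 0) :
    |y.eval 0| / 2 ≤ |y.eval (T ^ 2)| := by
  set f : ℝ → ℝ := fun s => N * y.eval s ^ 2 + s * (1 - s) * (derivative y).eval s ^ 2 with hf
  have hd := hasDerivAt_sonin y a b N hode
  have hanti : AntitoneOn f (Icc 0 (T ^ 2)) := by
    refine antitoneOn_of_deriv_nonpos (convex_Icc _ _)
      (fun x _ => (hd x).continuousAt.continuousWithinAt)
      (fun x _ => (hd x).differentiableAt.differentiableWithinAt) fun x hx => ?_
    rw [interior_Icc] at hx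
    rw [(hd x).deriv]
    refine mul_nonpos_of_nonpos_of_nonneg ?_ (sq_nonneg _)
    nlinarith [hx.2]
  have hbound (s : ℝ) (hs : s ∈ Icc 0 (T ^ 2)) :
      s * (derivative y).eval s ^ 2 ≤ 2 * N * y.eval 0 ^ 2 := by
    have h1 := hanti ⟨le_rfl, sq_nonneg T⟩ hs hs.1
    simp only [hf, zero_mul, add_zero] at h1
    have h2 : 0 ≤ N * y.eval s ^ 2 := by positivity
    have h3 : 0 ≤ s * (derivative y).eval s ^ 2 * (1 / 2 - s) :=
      mul_nonneg (mul_nonneg hs.1 (sq_nonneg _)) (by linarith [hs.2])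
    nlinarith
  have hY (t : ℝ) : HasDerivAt (fun t => y.eval (t ^ 2)) ((derivative y).eval (t ^ 2) * (2 * t)) t := by
    have := (y.hasDerivAt (t ^ 2)).comp t ((hasDerivAt_id t).pow 2)
    exact this.congr_deriv (by simp)
  have hmv := (convex_Icc (0 : ℝ) T).norm_image_sub_le_of_norm_hasDerivWithin_le
    (C := sqrt (8 * N) * |y.eval 0|) (fun t _ => (hY t).hasDerivWithinAt) (fun t ht => ?_)
    (left_mem_Icc.mpr hT) (right_mem_Icc.mpr hT)
  · have h1 : sqrt (8 * N) * T ≤ 1 / 2 := by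
      refine abs_le_of_sq_le_sq' ?_ (by norm_num) |>.2
      rw [mul_pow, sq_sqrt (by positivity)]
      linarith
    simp only [Real.norm_eq_abs, sub_zero, abs_of_nonneg hT, ne_eq, OfNat.ofNat_ne_zero,
      not_false_eq_true, zero_pow] at hmv
    have h2 : |y.eval 0| - |y.eval (T ^ 2)| ≤ |y.eval (T ^ 2) - y.eval 0| := by
      rw [abs_sub_comm]; exact abs_sub_abs_le_abs_sub _ _
    nlinarith [abs_nonneg (y.eval 0)]
  · rw [Real.norm_eq_abs]
    refine abs_le_of_sq_le_sq ?_ (by positivity)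
    rw [mul_pow (sqrt _), sq_sqrt (by positivity), sq_abs]
    have := hbound (t ^ 2) ⟨sq_nonneg t, pow_le_pow_left₀ ht.1 ht.2 2⟩
    nlinarith

open Filter Topology Asymptotics

theorem isTheta_natCast_add_const (c : ℝ) :
    (fun n : ℕ => (n : ℝ) + c) =Θ[atTop] fun n : ℕ => (n : ℝ) :=
  (IsEquivalent.refl.add_isLittleO
    ((isLittleO_const_id_atTop c).comp_tendsto tendsto_natCast_atTop_atTop)).isTheta

theorem Gamma_natCast_add_eq_mul_prod {s : ℝ} (hs : 0 < s) (n : ℕ) :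
    Gamma (n + s) = Gamma s * ∏ j ∈ Finset.range n, (s + j) := by
  induction n with
  | zero => simp
  | succ n ih =>
    rw [Finset.prod_range_succ, Nat.cast_succ, show (n : ℝ) + 1 + s = n + s + 1 by ring,
      Gamma_add_one (by positivity), ih]
    ring

theorem ascPochhammer_eval_eq_Gamma_div {s : ℝ} (hs : 0 < s) (n : ℕ) :
    (ascPochhammer ℝ n).eval s = Gamma (n + s) / Gamma s := by
  have hG : Gamma s ≠ 0 := (Gamma_pos_of_pos hs).ne'
  rw [Gamma_natCast_add_eq_mul_prod hs, mul_div_cancel_left₀ _ hG]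
  induction n with
  | zero => simp
  | succ n ih => rw [ascPochhammer_succ_eval, ih, Finset.prod_range_succ]

theorem isTheta_Gamma_natCast_add {s : ℝ} (hs : 0 < s) :
    (fun n : ℕ => Gamma (n + s)) =Θ[atTop]
      fun n : ℕ => (Nat.factorial n : ℝ) * (n : ℝ) ^ (s - 1) := by
  have hG : Gamma s ≠ 0 := (Gamma_pos_of_pos hs).ne'
  have h1 : GammaSeq s =Θ[atTop] fun _ : ℕ => Gamma s :=
    ((isEquivalent_const_iff_tendsto hG).mpr (GammaSeq_tendsto_Gamma s)).isTheta
  have h2 : (fun n : ℕ => Gamma s * ((n : ℝ) ^ s * Nat.factorial n) /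
      (GammaSeq s n * ((n : ℝ) + s))) =Θ[atTop]
      fun n : ℕ => Gamma s * ((n : ℝ) ^ s * Nat.factorial n) / (Gamma s * (n : ℝ)) :=
    (isTheta_refl _ _).div (h1.mul (isTheta_natCast_add_const s))
  refine (EventuallyEq.isTheta ?_).trans (h2.trans (EventuallyEq.isTheta ?_))
  · filter_upwards [eventually_gt_atTop 0] with n hn
    have hn' : (0 : ℝ) < n := by exact_mod_cast hn
    have hp : 0 < ∏ j ∈ Finset.range n, (s + (j : ℝ)) :=
      Finset.prod_pos fun j _ => by positivity
    have hr : (0 : ℝ) < (n : ℝ) ^ s := rpow_pos_of_pos hn' s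
    rw [Gamma_natCast_add_eq_mul_prod hs, GammaSeq, Finset.prod_range_succ]
    have hs' : s + n ≠ 0 := by positivity
    have hs'' : (n : ℝ) + s ≠ 0 := by positivity
    field_simp
    ring
  · filter_upwards [eventually_gt_atTop 0] with n hn
    have hn' : (0 : ℝ) < n := by exact_mod_cast hn
    rw [rpow_sub_one hn'.ne']
    field_simp

theorem isTheta_ascPochhammer_div_factorial {s : ℝ} (hs : 0 < s) :
    (fun n : ℕ => (ascPochhammer ℝ n).eval s / (Nat.factorial n : ℝ)) =Θ[atTop]
      fun n : ℕ => (n : ℝ) ^ (s - 1) := by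
  have hG : Gamma s ≠ 0 := (Gamma_pos_of_pos hs).ne'
  have h := ((isTheta_Gamma_natCast_add hs).div (isTheta_refl (fun n : ℕ => (Nat.factorial n : ℝ))
    atTop)).const_mul_left (c := (Gamma s)⁻¹) (inv_ne_zero hG)
  refine (EventuallyEq.isTheta ?_).trans (h.trans (EventuallyEq.isTheta ?_))
  · refine Eventually.of_forall fun n => ?_
    simp only [ascPochhammer_eval_eq_Gamma_div hs]
    ring
  · refine Eventually.of_forall fun n => ?_
    have : (Nat.factorial n : ℝ) ≠ 0 := by positivity
    field_simp

/-- A ratio of Gamma functions with total exponent `1` grows linearly. -/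
theorem isTheta_sqrt_Gamma_ratio {c u v w : ℝ} (hu : 0 < u + 1) (hv : 0 < v) (hw : 0 < w)
    (h : u + 1 = v + w) :
    (fun n : ℕ => (((2 * n + c) * Gamma (n + 1) * Gamma (n + u)) /
      (Gamma (n + v) * Gamma (n + w))) ^ ((1 : ℝ) / 2)) =Θ[atTop]
      fun n : ℕ => (n : ℝ) ^ ((1 : ℝ) / 2) := by
  have h2 : (fun n : ℕ => 2 * (n : ℝ) + c) =Θ[atTop] fun n : ℕ => (n : ℝ) := by
    refine (EventuallyEq.isTheta (Eventually.of_forall fun n => ?_)).trans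
      ((isTheta_natCast_add_const (c / 2)).const_mul_left (c := (2 : ℝ)) two_ne_zero)
    ring
  have hGu : (fun n : ℕ => Gamma (n + u)) =Θ[atTop]
      fun n : ℕ => (Nat.factorial n : ℝ) * (n : ℝ) ^ (u + 1 - 1) / n := by
    refine (EventuallyEq.isTheta ?_).trans
      ((isTheta_Gamma_natCast_add hu).div (isTheta_natCast_add_const u))
    filter_upwards [eventually_gt_atTop 0] with n hn
    have hn' : (1 : ℝ) ≤ n := by exact_mod_cast hn
    have hpos : (n : ℝ) + u ≠ 0 := by linarith
    rw [← add_assoc, Gamma_add_one hpos, mul_div_cancel_left₀ _ hpos]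
  have hall := ((h2.mul (isTheta_Gamma_natCast_add one_pos)).mul hGu).div
    ((isTheta_Gamma_natCast_add hv).mul (isTheta_Gamma_natCast_add hw))
  refine IsTheta.rpow ?_ (Eventually.of_forall fun n => Nat.cast_nonneg n)
    (hall.trans (EventuallyEq.isTheta ?_))
  · obtain ⟨k, hk⟩ := exists_nat_gt (max (-c) (-u))
    filter_upwards [eventually_ge_atTop k] with n hn
    have hn' : (k : ℝ) ≤ n := by exact_mod_cast hn
    have h0 : (0 : ℝ) ≤ n := Nat.cast_nonneg n
    have hc := (le_max_left (-c) (-u)).trans_lt hk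
    have hu' := (le_max_right (-c) (-u)).trans_lt hk
    have e1 : 0 ≤ Gamma ((n : ℝ) + u) := (Gamma_pos_of_pos (by linarith)).le
    have e2 : 0 ≤ Gamma ((n : ℝ) + 1) := (Gamma_pos_of_pos (by linarith)).le
    have e3 : 0 ≤ Gamma ((n : ℝ) + v) := (Gamma_pos_of_pos (by linarith)).le
    have e4 : 0 ≤ Gamma ((n : ℝ) + w) := (Gamma_pos_of_pos (by linarith)).le
    have e5 : 0 ≤ 2 * (n : ℝ) + c := by linarith
    simp only [Pi.zero_apply]
    positivity
  · filter_upwards [eventually_gt_atTop 0] with n hn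
    have hn' : (0 : ℝ) < n := by exact_mod_cast hn
    have hf : (0 : ℝ) < Nat.factorial n := by positivity
    rw [show u + 1 - 1 = (v - 1) + (w - 1) + 1 by linarith, rpow_add_one hn'.ne', rpow_add hn',
      sub_self, rpow_zero]
    have := rpow_pos_of_pos hn' (v - 1)
    have := rpow_pos_of_pos hn' (w - 1)
    field_simp

theorem isTheta_max_rpow {f g : ℕ → ℝ} {α β : ℝ} (hf0 : ∀ n, 0 ≤ f n) (hg0 : ∀ n, 0 ≤ g n)
    (hf : f =Θ[atTop] fun n : ℕ => (n : ℝ) ^ α) (hg : g =Θ[atTop] fun n : ℕ => (n : ℝ) ^ β) :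
    (fun n => max (f n) (g n)) =Θ[atTop] fun n : ℕ => (n : ℝ) ^ max α β := by
  have hmono {γ δ : ℝ} (h : γ ≤ δ) :
      (fun n : ℕ => (n : ℝ) ^ γ) =O[atTop] fun n : ℕ => (n : ℝ) ^ δ := by
    refine IsBigO.of_bound 1 ?_
    filter_upwards [eventually_gt_atTop 0] with n hn
    have hn' : (1 : ℝ) ≤ n := by exact_mod_cast hn
    rw [one_mul, norm_of_nonneg (by positivity), norm_of_nonneg (by positivity)]
    exact rpow_le_rpow_of_exponent_le hn' h
  constructor
  · refine IsBigO.trans (IsBigO.of_bound 1 (Eventually.of_forall fun n => ?_))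
      ((hf.1.trans (hmono (le_max_left α β))).add (hg.1.trans (hmono (le_max_right α β))))
    rw [one_mul, norm_of_nonneg (le_max_of_le_left (hf0 n)),
      norm_of_nonneg (add_nonneg (hf0 n) (hg0 n))]
    exact max_le (by linarith [hg0 n]) (by linarith [hf0 n])
  · rcases le_total α β with h | h
    · rw [max_eq_right h]
      refine hg.2.trans (IsBigO.of_bound 1 (Eventually.of_forall fun n => ?_))
      rw [one_mul, norm_of_nonneg (hg0 n), norm_of_nonneg (le_max_of_le_left (hf0 n))]
      exact le_max_right _ _
    · rw [max_eq_left h]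
      refine hf.2.trans (IsBigO.of_bound 1 (Eventually.of_forall fun n => ?_))
      rw [one_mul, norm_of_nonneg (hf0 n), norm_of_nonneg (le_max_of_le_left (hf0 n))]
      exact le_max_left _ _

theorem exists_bounds_of_isTheta {f g : ℕ → ℝ} (hf : ∀ᶠ n in atTop, 0 ≤ f n) (hg : ∀ n, 0 ≤ g n)
    (h : f =Θ[atTop] g) :
    ∃ c C : ℝ, 0 < c ∧ 0 < C ∧ ∀ᶠ n in atTop, c * g n ≤ f n ∧ f n ≤ C * g n := by
  obtain ⟨C, hC, h1⟩ := h.1.exists_pos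
  obtain ⟨c, hc, h2⟩ := h.2.exists_pos
  refine ⟨c⁻¹, C, inv_pos.mpr hc, hC, ?_⟩
  filter_upwards [hf, h1.bound, h2.bound] with n hn hn1 hn2
  rw [norm_of_nonneg hn, norm_of_nonneg (hg n)] at hn1 hn2
  exact ⟨by rw [inv_mul_le_iff₀ hc]; exact hn2, hn1⟩

/-- A sequence whose even and odd subsequences grow like `n ^ M` grows like `n ^ M`. -/
theorem exists_rpow_bounds_of_even_odd {S : ℕ → ℝ} {M : ℝ} (hM : 0 ≤ M) (hS : ∀ n, 0 ≤ S n)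
    (heven : (fun n => S (2 * n)) =Θ[atTop] fun n : ℕ => (n : ℝ) ^ M)
    (hodd : (fun n => S (2 * n + 1)) =Θ[atTop] fun n : ℕ => (n : ℝ) ^ M) :
    ∃ C₁ C₂ : ℝ, 0 < C₁ ∧ 0 < C₂ ∧ ∃ n₀ : ℕ, ∀ n : ℕ, n₀ ≤ n →
      C₁ * (n : ℝ) ^ M ≤ S n ∧ S n ≤ C₂ * (n : ℝ) ^ M := by
  have hpos (n : ℕ) : (0 : ℝ) ≤ (n : ℝ) ^ M := by positivity
  obtain ⟨c, C, hc, hC, h⟩ :=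
    exists_bounds_of_isTheta (Eventually.of_forall fun n => hS _) hpos heven
  obtain ⟨c', C', hc', hC', h'⟩ :=
    exists_bounds_of_isTheta (Eventually.of_forall fun n => hS _) hpos hodd
  obtain ⟨k, hk⟩ := eventually_atTop.mp (h.and h')
  have h3 : (0 : ℝ) < 3 ^ M := by positivity
  refine ⟨min c c' / 3 ^ M, max C C', div_pos (lt_min hc hc') h3, lt_max_of_lt_left hC,
    2 * k + 2, fun n hn => ?_⟩
  obtain ⟨⟨a1, a2⟩, b1, b2⟩ := hk (n / 2) (by omega)
  have hle : ((n / 2 : ℕ) : ℝ) ^ M ≤ (n : ℝ) ^ M := by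
    gcongr
    exact Nat.div_le_self n 2
  have hge : min c c' / 3 ^ M * (n : ℝ) ^ M ≤ min c c' * ((n / 2 : ℕ) : ℝ) ^ M := by
    rw [div_mul_eq_mul_div, div_le_iff₀ h3, mul_assoc, ← mul_rpow (by positivity) (by norm_num)]
    have : 0 ≤ min c c' := (lt_min hc hc').le
    gcongr
    have : n ≤ n / 2 * 3 := by omega
    exact_mod_cast this
  have hp := hpos (n / 2)
  rcases Nat.even_or_odd' n with ⟨j, hj | hj⟩
  · have hj' : 2 * (n / 2) = n := by omega
    rw [hj'] at a1 a2
    exact ⟨hge.trans ((mul_le_mul_of_nonneg_right (min_le_left _ _) hp).trans a1),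
      a2.trans (mul_le_mul (le_max_left _ _) hle hp (lt_max_of_lt_left hC).le)⟩
  · have hj' : 2 * (n / 2) + 1 = n := by omega
    rw [hj'] at b1 b2
    exact ⟨hge.trans ((mul_le_mul_of_nonneg_right (min_le_right _ _) hp).trans b1),
      b2.trans (mul_le_mul (le_max_right _ _) hle hp (lt_max_of_lt_left hC).le)⟩

theorem orthoGenGegenbauer_even (l m : ℝ) (n : ℕ) (t : ℝ) :
    orthoGenGegenbauer l m (2 * n) t =
      atilde2n l m n * (shiftedJacobi (l - 1 / 2) (m - 1 / 2) n).eval (t ^ 2) := by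
  rw [orthoGenGegenbauer, if_pos (even_two_mul n), shiftedJacobi_eval,
    Nat.mul_div_cancel_left n two_pos]

theorem orthoGenGegenbauer_odd (l m : ℝ) (n : ℕ) (t : ℝ) :
    orthoGenGegenbauer l m (2 * n + 1) t =
      atilde2n1 l m n * (t * (shiftedJacobi (l - 1 / 2) (m + 1 / 2) n).eval (t ^ 2)) := by
  rw [orthoGenGegenbauer, if_neg (by simp), shiftedJacobi_eval,
    show (2 * n + 1) / 2 = n by omega, mul_assoc]

theorem abs_shiftedJacobi_eval_zero_isTheta (a : ℝ) {b : ℝ} (hb : -1 < b) :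
    (fun n : ℕ => |(shiftedJacobi a b n).eval 0|) =Θ[atTop] fun n : ℕ => (n : ℝ) ^ b := by
  have h := isTheta_ascPochhammer_div_factorial (s := b + 1) (by linarith)
  rw [add_sub_cancel_right] at h
  refine (EventuallyEq.isTheta (Eventually.of_forall fun n => ?_)).trans h.norm_left
  simp only [shiftedJacobi_eval_zero, abs_mul, abs_pow, abs_neg, abs_one, one_pow, one_mul,
    norm_eq_abs]

theorem abs_shiftedJacobi_eval_one_isTheta {a : ℝ} (b : ℝ) (ha : -1 < a) :
    (fun n : ℕ => |(shiftedJacobi a b n).eval 1|) =Θ[atTop] fun n : ℕ => (n : ℝ) ^ a := by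
  have h := isTheta_ascPochhammer_div_factorial (s := a + 1) (by linarith)
  rw [add_sub_cancel_right] at h
  refine (EventuallyEq.isTheta (Eventually.of_forall fun n => ?_)).trans h.norm_left
  simp only [shiftedJacobi_eval_one, norm_eq_abs]

theorem isTheta_atilde2n {l m : ℝ} (hl : -(1 / 2 : ℝ) < l) (hm : 0 < m) :
    (fun n => |atilde2n l m n|) =Θ[atTop] fun n : ℕ => (n : ℝ) ^ ((1 : ℝ) / 2) := by
  refine IsTheta.trans (EventuallyEq.isTheta (Eventually.of_forall fun n => ?_))
    (isTheta_sqrt_Gamma_ratio (c := l + m) (u := l + m) (v := l + 1 / 2) (w := m + 1 / 2)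
      (by linarith) (by linarith) (by linarith) (by ring)).norm_left
  simp only [atilde2n, norm_eq_abs, add_assoc]

theorem isTheta_atilde2n1 {l m : ℝ} (hl : -(1 / 2 : ℝ) < l) (hm : 0 < m) :
    (fun n => |atilde2n1 l m n|) =Θ[atTop] fun n : ℕ => (n : ℝ) ^ ((1 : ℝ) / 2) := by
  refine IsTheta.trans (EventuallyEq.isTheta (Eventually.of_forall fun n => ?_))
    (isTheta_sqrt_Gamma_ratio (c := l + m + 1) (u := l + m + 1) (v := l + 1 / 2) (w := m + 3 / 2)
      (by linarith) (by linarith) (by linarith) (by ring)).norm_left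
  simp only [atilde2n1, norm_eq_abs, add_assoc]

theorem sSup_abs_image_le {f : ℝ → ℝ} {B : ℝ} (h : ∀ t ∈ Icc (-1 : ℝ) 1, |f t| ≤ B) :
    sSup ((fun t => |f t|) '' Icc (-1) 1) ≤ B := by
  refine csSup_le ⟨_, mem_image_of_mem _ (show (1 : ℝ) ∈ Icc (-1 : ℝ) 1 by simp)⟩ ?_
  rintro _ ⟨t, ht, rfl⟩
  exact h t ht

theorem abs_le_sSup_image {f : ℝ → ℝ} {B : ℝ} (h : ∀ t ∈ Icc (-1 : ℝ) 1, |f t| ≤ B) {t : ℝ}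
    (ht : t ∈ Icc (-1 : ℝ) 1) : |f t| ≤ sSup ((fun t => |f t|) '' Icc (-1) 1) := by
  refine le_csSup ⟨B, ?_⟩ (mem_image_of_mem _ ht)
  rintro _ ⟨t, ht, rfl⟩
  exact h t ht

theorem sq_mem_Icc {t : ℝ} (ht : t ∈ Icc (-1 : ℝ) 1) : t ^ 2 ∈ Icc (0 : ℝ) 1 :=
  ⟨sq_nonneg t, (sq_le_one_iff_abs_le_one t).mpr (abs_le.mpr ht)⟩

/-- The maximum of an even-degree generalized Gegenbauer polynomial is attained at `0` or `1`. -/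
theorem sSup_abs_orthoGenGegenbauer_even {l m : ℝ} (hl : -(1 / 2 : ℝ) < l) (hm : 0 < m) {n : ℕ}
    (hn : 0 < n) :
    sSup ((fun t => |orthoGenGegenbauer l m (2 * n) t|) '' Icc (-1) 1) =
      |atilde2n l m n| * max |(shiftedJacobi (l - 1 / 2) (m - 1 / 2) n).eval 1|
        |(shiftedJacobi (l - 1 / 2) (m - 1 / 2) n).eval 0| := by
  set y := shiftedJacobi (l - 1 / 2) (m - 1 / 2) n with hy
  have hn' : (1 : ℝ) ≤ n := by exact_mod_cast hn
  have hupper : ∀ t ∈ Icc (-1 : ℝ) 1,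
      |orthoGenGegenbauer l m (2 * n) t| ≤ |atilde2n l m n| * max |y.eval 1| |y.eval 0| := by
    intro t ht
    have h := sq_eval_le_max_of_ode y (mul_pos (by linarith) (by linarith)) (by linarith)
      (shiftedJacobi_ode (l - 1 / 2) (m - 1 / 2) n) (sq_mem_Icc ht)
    rw [orthoGenGegenbauer_even, abs_mul, ← hy]
    gcongr
    rcases le_max_iff.mp h with h | h
    · exact le_max_of_le_right (sq_le_sq.mp h)
    · exact le_max_of_le_left (sq_le_sq.mp h)
  refine le_antisymm (sSup_abs_image_le hupper) ?_
  have h0 := abs_le_sSup_image hupper (t := 0) (by simp)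
  have h1 := abs_le_sSup_image hupper (t := 1) (by simp)
  rw [orthoGenGegenbauer_even, abs_mul, ← hy] at h0 h1
  rw [mul_max_of_nonneg _ _ (abs_nonneg _)]
  exact max_le (by simpa using h1) (by simpa using h0)

theorem abs_mul_shiftedJacobi_le {l m : ℝ} (hl : -(1 / 2 : ℝ) < l) (hm : 0 < m) {n : ℕ}
    (hn : 0 < n) {t : ℝ} (ht : t ∈ Icc (-1 : ℝ) 1) :
    |t * (shiftedJacobi (l - 1 / 2) (m + 1 / 2) n).eval (t ^ 2)| ≤
      sqrt (exp (|l + m| / m) * (1 + m / 2)) *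
        max |(shiftedJacobi (l - 1 / 2) (m + 1 / 2) n).eval 1|
          (|(shiftedJacobi (l - 1 / 2) (m + 1 / 2) n).eval 0| / n) := by
  have hode := shiftedJacobi_ode (l - 1 / 2) (m + 1 / 2) n
  generalize shiftedJacobi (l - 1 / 2) (m + 1 / 2) n = y at hode ⊢
  have hn' : (1 : ℝ) ≤ n := by exact_mod_cast hn
  have hn0 : (0 : ℝ) < n := by linarith
  have hNlow : (n : ℝ) ^ 2 ≤
      n * (n + (l - 1 / 2) + (m + 1 / 2) + 1) + 1 / 4 - (l + m) / 2 := by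
    nlinarith
  generalize (n : ℝ) * (n + (l - 1 / 2) + (m + 1 / 2) + 1) = N at hode hNlow
  have h := mul_sq_eval_le_max_of_ode y hm ((sq_nonneg (n : ℝ)).trans hNlow) hode (sq_mem_Icc ht)
  generalize N + 1 / 4 - (l + m) / 2 = D at h hNlow
  have h1 : |y.eval 0| ≤ n * max |y.eval 1| (|y.eval 0| / n) := by
    rw [← div_le_iff₀' hn0]
    exact le_max_right _ _
  have h2 : |y.eval 1| ≤ max |y.eval 1| (|y.eval 0| / n) := le_max_left _ _
  generalize max |y.eval 1| (|y.eval 0| / n) = Y at h1 h2 ⊢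
  have hY0 : 0 ≤ Y := (abs_nonneg _).trans h2
  have hD1 : 1 ≤ D := (one_le_pow₀ hn').trans hNlow
  have hz : y.eval 0 ^ 2 ≤ D * Y ^ 2 := by
    calc y.eval 0 ^ 2 ≤ (n * Y) ^ 2 := by
          rw [← sq_abs]
          gcongr
      _ = n ^ 2 * Y ^ 2 := mul_pow _ _ _
      _ ≤ D * Y ^ 2 := by gcongr
  have ho : y.eval 1 ^ 2 ≤ Y ^ 2 := by
    rw [← sq_abs]
    gcongr
  have hmax : max ((m / 2 + 1 / 4) * y.eval 0 ^ 2) ((D + m / 2) * y.eval 1 ^ 2) ≤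
      D * ((1 + m / 2) * Y ^ 2) := by
    refine max_le ?_ ?_
    · calc (m / 2 + 1 / 4) * y.eval 0 ^ 2 ≤ (1 + m / 2) * (D * Y ^ 2) := by
            gcongr ?_ * ?_
            linarith
        _ = D * ((1 + m / 2) * Y ^ 2) := by ring
    · calc (D + m / 2) * y.eval 1 ^ 2 ≤ (D * (1 + m / 2)) * Y ^ 2 := by
            gcongr ?_ * ?_
            nlinarith
        _ = D * ((1 + m / 2) * Y ^ 2) := by ring
  have h3 : D * (t ^ 2 * y.eval (t ^ 2) ^ 2) ≤
      D * (exp (|l + m| / m) * (1 + m / 2) * Y ^ 2) := by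
    refine h.trans ((mul_le_mul_of_nonneg_left hmax (exp_pos _).le).trans_eq ?_)
    ring
  refine abs_le_of_sq_le_sq ?_ (by positivity)
  rw [mul_pow, mul_pow, sq_sqrt (by positivity)]
  exact le_of_mul_le_mul_left h3 (by linarith)

theorem exists_half_abs_shiftedJacobi_eval_zero_le {l m : ℝ} (hl : -(1 / 2 : ℝ) < l)
    (hm : 0 < m) :
    ∃ c : ℝ, 0 < c ∧ c ≤ 1 ∧ ∀ n : ℕ, 0 < n →
      |(shiftedJacobi (l - 1 / 2) (m + 1 / 2) n).eval 0| / 2 ≤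
        |(shiftedJacobi (l - 1 / 2) (m + 1 / 2) n).eval ((c / n) ^ 2)| := by
  have hR : 1 < l + m + 2 := by linarith
  have hc2 : sqrt (1 / (32 * (l + m + 2))) ^ 2 = 1 / (32 * (l + m + 2)) :=
    sq_sqrt (by positivity)
  have hcpos : 0 < sqrt (1 / (32 * (l + m + 2))) := sqrt_pos.mpr (by positivity)
  generalize sqrt (1 / (32 * (l + m + 2))) = c at hc2 hcpos
  have hcR : c ^ 2 * (l + m + 2) = 1 / 32 := by
    rw [hc2]
    field_simp
  have hc32 : c ^ 2 ≤ 1 / 32 := by nlinarith [sq_nonneg c]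
  refine ⟨c, hcpos, by nlinarith, fun n hn => ?_⟩
  have hn' : (1 : ℝ) ≤ n := by exact_mod_cast hn
  have hn0 : (0 : ℝ) < n := by linarith
  have hT2 : (c / n) ^ 2 ≤ c ^ 2 := by
    gcongr
    exact div_le_self hcpos.le hn'
  have hNup : (n : ℝ) * (n + (l - 1 / 2) + (m + 1 / 2) + 1) ≤ n ^ 2 * (l + m + 2) := by
    nlinarith [mul_nonneg (mul_nonneg hn0.le (sub_nonneg.mpr hn')) (by linarith : 0 ≤ l + m + 1)]
  refine half_abs_eval_zero_le_of_ode _ (mul_nonneg hn0.le (by linarith)) (by positivity)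
    (by linarith) ?_ (by linarith) ?_ (shiftedJacobi_ode (l - 1 / 2) (m + 1 / 2) n)
  · calc 2 * (l - 1 / 2 + (m + 1 / 2) + 1) * (c / n) ^ 2
        ≤ 2 * (l + m + 2) * c ^ 2 := by
          gcongr ?_ * ?_
          linarith
      _ ≤ 2 * (m + 1 / 2) + 1 := by linarith
  · calc 32 * ((n : ℝ) * (n + (l - 1 / 2) + (m + 1 / 2) + 1)) * (c / n) ^ 2
        ≤ 32 * (n ^ 2 * (l + m + 2)) * (c / n) ^ 2 := by gcongr
      _ = 32 * (c ^ 2 * (l + m + 2)) := by field_simp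
      _ ≤ 1 := by rw [hcR]; norm_num

theorem exists_sSup_abs_orthoGenGegenbauer_odd_bounds {l m : ℝ} (hl : -(1 / 2 : ℝ) < l)
    (hm : 0 < m) :
    ∃ c C : ℝ, 0 < c ∧ 0 < C ∧ ∀ n : ℕ, 0 < n →
      c * (|atilde2n1 l m n| * max |(shiftedJacobi (l - 1 / 2) (m + 1 / 2) n).eval 1|
        (|(shiftedJacobi (l - 1 / 2) (m + 1 / 2) n).eval 0| / n)) ≤
        sSup ((fun t => |orthoGenGegenbauer l m (2 * n + 1) t|) '' Icc (-1) 1) ∧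
      sSup ((fun t => |orthoGenGegenbauer l m (2 * n + 1) t|) '' Icc (-1) 1) ≤
        C * (|atilde2n1 l m n| * max |(shiftedJacobi (l - 1 / 2) (m + 1 / 2) n).eval 1|
        (|(shiftedJacobi (l - 1 / 2) (m + 1 / 2) n).eval 0| / n)) := by
  obtain ⟨c, hcpos, hc1, hhalf⟩ := exists_half_abs_shiftedJacobi_eval_zero_le hl hm
  refine ⟨c / 2, sqrt (exp (|l + m| / m) * (1 + m / 2)), by positivity,
    sqrt_pos.mpr (by positivity), fun n hn => ?_⟩
  have hn' : (1 : ℝ) ≤ n := by exact_mod_cast hn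
  have hupper : ∀ t ∈ Icc (-1 : ℝ) 1, |orthoGenGegenbauer l m (2 * n + 1) t| ≤
      sqrt (exp (|l + m| / m) * (1 + m / 2)) *
        (|atilde2n1 l m n| * max |(shiftedJacobi (l - 1 / 2) (m + 1 / 2) n).eval 1|
        (|(shiftedJacobi (l - 1 / 2) (m + 1 / 2) n).eval 0| / n)) := by
    intro t ht
    rw [orthoGenGegenbauer_odd, abs_mul, mul_left_comm]
    exact mul_le_mul_of_nonneg_left (abs_mul_shiftedJacobi_le hl hm hn ht) (abs_nonneg _)
  refine ⟨?_, sSup_abs_image_le hupper⟩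
  have hT0 : 0 ≤ c / n := by positivity
  have hT1 : c / n ≤ 1 := (div_le_self hcpos.le hn').trans hc1
  have h0 := abs_le_sSup_image hupper (t := c / n) ⟨by linarith, hT1⟩
  have h1 := abs_le_sSup_image hupper (t := 1) (by simp)
  have hh := hhalf n hn
  rw [orthoGenGegenbauer_odd, abs_mul] at h0 h1
  generalize shiftedJacobi (l - 1 / 2) (m + 1 / 2) n = y at h0 h1 hh ⊢
  rw [mul_left_comm, mul_max_of_nonneg _ _ (by positivity : 0 ≤ c / 2),
    mul_max_of_nonneg _ _ (abs_nonneg _)]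
  refine max_le ?_ ?_
  · refine le_trans (mul_le_mul_of_nonneg_left ?_ (abs_nonneg _)) h1
    simp only [one_pow, one_mul]
    nlinarith [abs_nonneg (y.eval 1)]
  · refine le_trans (mul_le_mul_of_nonneg_left ?_ (abs_nonneg _)) h0
    rw [abs_mul, abs_of_nonneg hT0]
    calc c / 2 * (|y.eval 0| / n) = c / n * (|y.eval 0| / 2) := by ring
      _ ≤ c / n * |y.eval ((c / n) ^ 2)| := mul_le_mul_of_nonneg_left hh hT0

theorem natCast_rpow_mul_rpow_eventuallyEq {l m : ℝ} :
    (fun n : ℕ => (n : ℝ) ^ ((1 : ℝ) / 2) * (n : ℝ) ^ max (l - 1 / 2) (m - 1 / 2)) =ᶠ[atTop]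
      fun n : ℕ => (n : ℝ) ^ max l m := by
  filter_upwards [eventually_gt_atTop 0] with n hn
  rw [← rpow_add (by exact_mod_cast hn), max_sub_sub_right, add_sub_cancel]

theorem isTheta_sSup_abs_orthoGenGegenbauer_even {l m : ℝ} (hl : -(1 / 2 : ℝ) < l) (hm : 0 < m) :
    (fun n => sSup ((fun t => |orthoGenGegenbauer l m (2 * n) t|) '' Icc (-1) 1)) =Θ[atTop]
      fun n : ℕ => (n : ℝ) ^ max l m := by
  have h := (isTheta_atilde2n hl hm).mul (isTheta_max_rpow (fun _ => abs_nonneg _)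
    (fun _ => abs_nonneg _)
    (abs_shiftedJacobi_eval_one_isTheta (a := l - 1 / 2) (m - 1 / 2) (by linarith))
    (abs_shiftedJacobi_eval_zero_isTheta (l - 1 / 2) (b := m - 1 / 2) (by linarith)))
  refine IsTheta.trans (EventuallyEq.isTheta ?_)
    (h.trans_eventuallyEq natCast_rpow_mul_rpow_eventuallyEq)
  filter_upwards [eventually_gt_atTop 0] with n hn
  exact sSup_abs_orthoGenGegenbauer_even hl hm hn

theorem isTheta_sSup_abs_orthoGenGegenbauer_odd {l m : ℝ} (hl : -(1 / 2 : ℝ) < l) (hm : 0 < m) :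
    (fun n => sSup ((fun t => |orthoGenGegenbauer l m (2 * n + 1) t|) '' Icc (-1) 1)) =Θ[atTop]
      fun n : ℕ => (n : ℝ) ^ max l m := by
  have hzero : (fun n : ℕ => |(shiftedJacobi (l - 1 / 2) (m + 1 / 2) n).eval 0| / n) =Θ[atTop]
      fun n : ℕ => (n : ℝ) ^ (m - 1 / 2) := by
    refine ((abs_shiftedJacobi_eval_zero_isTheta (l - 1 / 2) (b := m + 1 / 2) (by linarith)).div
      (isTheta_refl (fun n : ℕ => (n : ℝ)) atTop)).trans_eventuallyEq ?_
    filter_upwards [eventually_gt_atTop 0] with n hn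
    have hn' : (0 : ℝ) < n := by exact_mod_cast hn
    rw [← rpow_sub_one hn'.ne']
    congr 1
    ring
  have h := (isTheta_atilde2n1 hl hm).mul (isTheta_max_rpow (fun _ => abs_nonneg _)
    (fun _ => by positivity)
    (abs_shiftedJacobi_eval_one_isTheta (a := l - 1 / 2) (m + 1 / 2) (by linarith)) hzero)
  refine IsTheta.trans ?_ (h.trans_eventuallyEq natCast_rpow_mul_rpow_eventuallyEq)
  obtain ⟨c, C, hc, hC, hbd⟩ := exists_sSup_abs_orthoGenGegenbauer_odd_bounds hl hm
  have hX (n : ℕ) : 0 ≤ |atilde2n1 l m n| *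
      max |(shiftedJacobi (l - 1 / 2) (m + 1 / 2) n).eval 1|
        (|(shiftedJacobi (l - 1 / 2) (m + 1 / 2) n).eval 0| / n) :=
    mul_nonneg (abs_nonneg _) (le_max_of_le_left (abs_nonneg _))
  constructor
  · refine IsBigO.of_bound C ?_
    filter_upwards [eventually_gt_atTop 0] with n hn
    have h0 := (mul_nonneg hc.le (hX n)).trans (hbd n hn).1
    rw [norm_of_nonneg h0, norm_of_nonneg (hX n)]
    exact (hbd n hn).2
  · refine IsBigO.of_bound c⁻¹ ?_
    filter_upwards [eventually_gt_atTop 0] with n hn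
    have h0 := (mul_nonneg hc.le (hX n)).trans (hbd n hn).1
    rw [norm_of_nonneg h0, norm_of_nonneg (hX n), ← div_eq_inv_mul, le_div_iff₀' hc]
    exact (hbd n hn).1

theorem main_orthoGenGegenbauer_max_asymp (l m : ℝ) (hl : -(1 / 2 : ℝ) < l) (hm : 0 < m) :
    ∃ C₁ C₂ : ℝ, 0 < C₁ ∧ 0 < C₂ ∧ ∃ n₀ : ℕ, ∀ n : ℕ, n₀ ≤ n →
      C₁ * (n : ℝ) ^ (max l m) ≤
        sSup ((fun t : ℝ => |orthoGenGegenbauer l m n t|) '' Set.Icc (-1) 1) ∧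
      sSup ((fun t : ℝ => |orthoGenGegenbauer l m n t|) '' Set.Icc (-1) 1) ≤
        C₂ * (n : ℝ) ^ (max l m) :=
  exists_rpow_bounds_of_even_odd (le_max_of_le_right hm.le)
    (fun _ => Real.sSup_nonneg (by rintro _ ⟨t, -, rfl⟩; exact abs_nonneg _))
    (isTheta_sSup_abs_orthoGenGegenbauer_even hl hm)
    (isTheta_sSup_abs_orthoGenGegenbauer_odd hl hm)
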